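/- arXiv:2202.08518 — 2 statements merged into one kernel-verified Lean document; each statement's English description precedes it below -/
import Mathlib

section
/- Let G = (−1, 1) ⊂ ℝ and define the point pair function p(x,y) = |x − y|/√((x − y)² + 4(1 − |x|)(1 − |y|)) for x, y ∈ G. Then for all x, y, z ∈ G, p(x,y) ≤ (√5/2)(p(x,z) + p(z,y)). -/
/-- The point pair function of the interval. -/
noncomputable def ppq (x y : ℝ) : ℝ :=
  |x - y| / Real.sqrt ((x - y)^2 + 4*(1 - |x|)*(1 - |y|))

lemma ppq_comm (x y : ℝ) : ppq x y = ppq y x := by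
  unfold ppq
  rw [abs_sub_comm]
  congr 2
  ring

lemma ppq_neg (x y : ℝ) : ppq (-x) (-y) = ppq x y := by
  unfold ppq
  rw [abs_neg, abs_neg, show -x - -y = -(x - y) by ring, abs_neg, neg_sq]

lemma ppq_nonneg (x y : ℝ) : 0 ≤ ppq x y := by
  unfold ppq; positivity

lemma div_sqrt_mono {s t c d : ℝ} (hs : 0 ≤ s) (hst : s ≤ t) (hd : 0 < d) (hdc : d ≤ c) :
    s / Real.sqrt (s^2 + c) ≤ t / Real.sqrt (t^2 + d) := by
  have h1 : 0 < s^2 + c := by nlinarith [sq_nonneg s]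
  have h2 : 0 < t^2 + d := by nlinarith [sq_nonneg t]
  rw [div_le_div_iff₀ (Real.sqrt_pos.2 h1) (Real.sqrt_pos.2 h2)]
  have ht : 0 ≤ t := hs.trans hst
  apply le_of_sq_le_sq _ (by positivity)
  rw [mul_pow, mul_pow, Real.sq_sqrt h1.le, Real.sq_sqrt h2.le]
  have : s^2 ≤ t^2 := by gcongr
  have : s^2 * d ≤ t^2 * c := by gcongr
  nlinarith

lemma ppq_same {x y : ℝ} (hx : 0 ≤ x) (hy : 0 ≤ y) (hx1 : x < 1) (hy1 : y < 1) :
    ppq x y = |x - y| / (2 - x - y) := by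
  unfold ppq
  rw [abs_of_nonneg hx, abs_of_nonneg hy,
    show (x - y)^2 + 4*(1 - x)*(1 - y) = (2 - x - y)^2 by ring, Real.sqrt_sq (by linarith)]

lemma ppq_opp {u v : ℝ} (hu : 0 ≤ u) (hv : 0 ≤ v) :
    ppq (-u) v = (u + v) / Real.sqrt ((u + v)^2 + 4*(1 - u)*(1 - v)) := by
  unfold ppq
  rw [abs_neg, abs_of_nonneg hu, abs_of_nonneg hv, show -u - v = -(u + v) by ring, abs_neg,
    neg_sq, abs_of_nonneg (add_nonneg hu hv)]

lemma ppq_abs_le {x z : ℝ} (hx : 0 ≤ x) (hx1 : x < 1) (hz : |z| < 1) :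
    ppq x |z| ≤ ppq x z := by
  unfold ppq
  rw [abs_abs, ← sq_abs (x - (|z|)), ← sq_abs (x - z)]
  have h : |x - (|z|)| ≤ |x - z| := by
    have := abs_abs_sub_abs_le_abs_sub x z
    rwa [abs_of_nonneg hx] at this
  have hp : 0 < 4 * (1 - |x|) * (1 - |z|) := by
    rw [abs_of_nonneg hx]
    have : 0 < 1 - x := by linarith
    have : 0 < 1 - |z| := by linarith
    positivity
  exact div_sqrt_mono (abs_nonneg _) h hp le_rfl

lemma tri_ord {a b c : ℝ} (ha : 0 < a) (hb : 0 < b) (hc : 0 < c) :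
    (b - a) / (a + b) ≤ |a - c| / (a + c) + |c - b| / (c + b) := by
  have e1 : (c - a) / (a + c) ≤ |a - c| / (a + c) := by
    gcongr; rw [abs_sub_comm]; exact le_abs_self _
  have e2 : (b - c) / (c + b) ≤ |c - b| / (c + b) := by
    gcongr; rw [abs_sub_comm]; exact le_abs_self _
  rcases le_total a b with hab | hab
  · rcases le_total c a with hca | hca
    · have : (b - a) / (a + b) ≤ (b - c) / (c + b) := by
        rw [div_le_div_iff₀ (by linarith) (by linarith)]
        nlinarith
      have : 0 ≤ |a - c| / (a + c) := by positivity
      linarith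
    · rcases le_total c b with hcb | hcb
      · have : (b - a) / (a + b) ≤ (c - a) / (a + c) + (b - c) / (c + b) := by
          have : (c - a) / (a + c) + (b - c) / (c + b) - (b - a) / (a + b)
              = (c - a) * (b - c) * (b - a) / ((a + c) * (c + b) * (a + b)) := by
            field_simp; ring
          have : 0 ≤ (c - a) * (b - c) * (b - a) / ((a + c) * (c + b) * (a + b)) := by
            have := sub_nonneg.2 hca
            have := sub_nonneg.2 hcb
            have := sub_nonneg.2 hab
            positivity
          linarith
        linarith
      · have : (b - a) / (a + b) ≤ (c - a) / (a + c) := by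
          rw [div_le_div_iff₀ (by linarith) (by linarith)]
          nlinarith
        have : 0 ≤ |c - b| / (c + b) := by positivity
        linarith
  · have : (b - a) / (a + b) ≤ 0 := div_nonpos_of_nonpos_of_nonneg (by linarith) (by linarith)
    have : 0 ≤ |a - c| / (a + c) := by positivity
    have : 0 ≤ |c - b| / (c + b) := by positivity
    linarith

lemma tri_abs {a b c : ℝ} (ha : 0 < a) (hb : 0 < b) (hc : 0 < c) :
    |a - b| / (a + b) ≤ |a - c| / (a + c) + |c - b| / (c + b) := by
  rcases le_total a b with h | h
  · rw [abs_sub_comm a b, abs_of_nonneg (sub_nonneg.2 h)]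
    exact tri_ord ha hb hc
  · rw [abs_of_nonneg (sub_nonneg.2 h)]
    have := tri_ord hb ha hc
    rw [abs_sub_comm b c, abs_sub_comm c a, add_comm b a, add_comm b c, add_comm c a] at this
    linarith

lemma ppq_tri_same {x y z : ℝ} (hx : 0 ≤ x) (hy : 0 ≤ y) (hx1 : x < 1) (hy1 : y < 1)
    (hz : |z| < 1) : ppq x y ≤ ppq x z + ppq z y := by
  have h1 := ppq_abs_le hx hx1 hz
  have h2 := ppq_abs_le hy hy1 hz
  rw [ppq_comm z y]
  refine le_trans ?_ (add_le_add h1 h2)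
  rw [ppq_same hx hy hx1 hy1, ppq_same hx (abs_nonneg z) hx1 hz,
    ppq_same hy (abs_nonneg z) hy1 hz]
  have := tri_abs (a := 1 - x) (b := 1 - y) (c := 1 - |z|) (by linarith) (by linarith)
    (by linarith)
  rw [show 1 - x - (1 - y) = -(x - y) by ring, show 1 - x - (1 - |z|) = -(x - |z|) by ring,
    show 1 - |z| - (1 - y) = y - |z| by ring, abs_neg, abs_neg,
    show 1 - x + (1 - y) = 2 - x - y by ring, show 1 - x + (1 - |z|) = 2 - x - |z| by ring,
    show 1 - |z| + (1 - y) = 2 - y - |z| by ring] at this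
  exact this

lemma Q_pos {u v : ℝ} (hu : 0 ≤ u) (hv : 0 ≤ v) (hu1 : u < 1) (hv1 : v < 1) :
    0 < (u + v)^2 + 4*(1 - u)*(1 - v) := by
  have : 0 < 1 - u := by linarith
  have : 0 < 1 - v := by linarith
  positivity

lemma D_pos {u v : ℝ} (hu : 0 ≤ u) (hv : 0 ≤ v) (hu1 : u < 1) (hv1 : v < 1) :
    0 < 2 - u - v + 2*u*v := by
  have : 0 ≤ u * v := by positivity
  linarith

lemma low_bound {u w : ℝ} (hu : 0 ≤ u) (hw : 0 ≤ w) (hu1 : u < 1) (hw1 : w < 1) :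
    (u + w) / (2 - u - w + 2*u*w) ≤ (u + w) / Real.sqrt ((u + w)^2 + 4*(1 - u)*(1 - w)) := by
  have hs := Real.sqrt_pos.2 (Q_pos hu hw hu1 hw1)
  have : Real.sqrt ((u + w)^2 + 4*(1 - u)*(1 - w)) ≤ 2 - u - w + 2*u*w := by
    rw [Real.sqrt_le_left (D_pos hu hw hu1 hw1).le]
    have h1 : 0 ≤ (u * w) * ((1 - u) * (1 - w)) :=
      mul_nonneg (mul_nonneg hu hw) (mul_nonneg (by linarith) (by linarith))
    nlinarith
  gcongr

lemma sqrt5_bound {N M Q : ℝ} (hQ : 0 < Q) (hM : 0 < M) (hN : 0 ≤ N)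
    (h : 4 * M^2 ≤ 5 * Q) : N / Real.sqrt Q ≤ Real.sqrt 5 / 2 * (N / M) := by
  have hs := Real.sqrt_pos.2 hQ
  have : 2 * M ≤ Real.sqrt 5 * Real.sqrt Q := by
    rw [← Real.sqrt_mul (by norm_num)]
    apply Real.le_sqrt_of_sq_le
    linarith
  rw [show Real.sqrt 5 / 2 * (N / M) = (Real.sqrt 5 * N) / (2 * M) by field_simp,
    div_le_div_iff₀ hs (by positivity)]
  nlinarith

lemma g_exists {u v : ℝ} (hu : 0 ≤ u) (hv : 0 ≤ v) (hu1 : u < 1) (hv1 : v < 1) :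
    ∃ g : ℝ, 0 ≤ g ∧ g < 1 ∧ g^2 = u * v ∧ 2 * g ≤ u + v := by
  have h0 : 0 ≤ u * v := by positivity
  refine ⟨Real.sqrt (u * v), Real.sqrt_nonneg _, ?_, Real.sq_sqrt h0, ?_⟩
  · rw [Real.sqrt_lt' one_pos]; nlinarith
  · apply le_of_sq_le_sq _ (by positivity)
    rw [mul_pow, Real.sq_sqrt h0]
    nlinarith [sq_nonneg (u - v)]

lemma end_v {u v : ℝ} (hu : 0 ≤ u) (hv : 0 ≤ v) (hu1 : u < 1) (hv1 : v < 1) :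
    4 * (2 - u - v + 2*u*v)^2 ≤ 5 * ((u + v)^2 + 4*(1 - u)*(1 - v)) := by
  obtain ⟨g, hg0, hg1, hg, hgP⟩ := g_exists hu hv hu1 hv1
  obtain ⟨R, hR⟩ : ∃ R, R = 2 - u - v := ⟨_, rfl⟩
  have e1 : 2 - u - v + 2*u*v = R + 2*g^2 := by rw [hR, hg]; ring
  have e2 : (u + v)^2 + 4*(1 - u)*(1 - v) = R^2 + 4*g^2 := by rw [hR, hg]; ring
  rw [e1, e2]
  have hR2 : R ≤ 2 - 2*g := by linarith
  rcases le_total g (1/2) with h | h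
  · have : 0 ≤ g^2 * (1 - 4*g^2) := mul_nonneg (sq_nonneg g) (by nlinarith)
    nlinarith [sq_nonneg (R - 8*g^2)]
  · have : 0 ≤ g^2 * (20 - 16*g^2 - 16*R) := mul_nonneg (sq_nonneg g) (by nlinarith)
    nlinarith [sq_nonneg R]

lemma end_zero {u v : ℝ} (hu : 0 ≤ u) (hv : 0 ≤ v) (hu1 : u < 1) (hv1 : v < 1) :
    (u + v) / Real.sqrt ((u + v)^2 + 4*(1 - u)*(1 - v))
      ≤ Real.sqrt 5 / 2 * (u / (2 - u) + v / (2 - v)) := by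
  obtain ⟨g, hg0, hg1, hg, hgP⟩ := g_exists hu hv hu1 hv1
  obtain ⟨R, hR⟩ : ∃ R, R = 2 - u - v := ⟨_, rfl⟩
  obtain ⟨P, hP⟩ : ∃ P, P = u + v := ⟨_, rfl⟩
  have hRpos : 0 < R := by linarith
  have e2 : (u + v)^2 + 4*(1 - u)*(1 - v) = R^2 + 4*g^2 := by rw [hR, hg]; ring
  have hQ := Q_pos hu hv hu1 hv1
  have hu2 : 0 < 2 - u := by linarith
  have hv2 : 0 < 2 - v := by linarith
  have e3 : u / (2 - u) + v / (2 - v) = 2 * (P - g^2) / (2 * R + g^2) := by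
    rw [hg, hP, hR, show 2 * (2 - u - v) + u * v = (2 - u) * (2 - v) by ring]
    field_simp; ring
  rw [e3, e2, ← hP]
  rw [e2] at hQ
  have hs := Real.sqrt_pos.2 hQ
  have hc : 2 * R + 2 * g ≤ Real.sqrt 5 * Real.sqrt (R^2 + 4*g^2) := by
    rw [← Real.sqrt_mul (by norm_num)]
    apply Real.le_sqrt_of_sq_le
    nlinarith [sq_nonneg (R - 4 * g)]
  have hPg : 0 ≤ P - g^2 := by
    rw [hg, hP]; nlinarith
  have hk : P * (2 * R + g^2) ≤ (2 * R + 2 * g) * (P - g^2) := by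
    have : 0 ≤ g * ((P - 2 * g) * (2 + g)) :=
      mul_nonneg hg0 (mul_nonneg (by linarith) (by linarith))
    have : R = 2 - P := by linarith
    subst this
    nlinarith
  have hk2 := mul_le_mul_of_nonneg_right hc hPg
  have hM : 0 < 2 * R + g^2 := by positivity
  rw [show Real.sqrt 5 / 2 * (2 * (P - g^2) / (2 * R + g^2))
    = Real.sqrt 5 * (P - g^2) / (2 * R + g^2) by field_simp, div_le_div_iff₀ hs hM]
  nlinarith

lemma key {u v w : ℝ} (hu : 0 ≤ u) (hw : 0 ≤ w) (hwv : w ≤ v) (hu1 : u < 1) (hv1 : v < 1) :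
    (u + v) / Real.sqrt ((u + v)^2 + 4*(1 - u)*(1 - v))
      ≤ Real.sqrt 5 / 2 * ((u + w) / (2 - u - w + 2*u*w) + (v - w) / (2 - v - w)) := by
  have hv : 0 ≤ v := hw.trans hwv
  have hw1 : w < 1 := by linarith
  have hDw := D_pos hu hw hu1 hw1
  have hDv := D_pos hu hv hu1 hv1
  have hu2 : 0 < 2 - u := by linarith
  have hv2 : 0 < 2 - v := by linarith
  have hvw : 0 < 2 - v - w := by linarith
  have h5 : 0 ≤ Real.sqrt 5 / 2 := by positivity
  obtain ⟨Dw, eDw⟩ : ∃ D, D = 2 - u - w + 2*u*w := ⟨_, rfl⟩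
  obtain ⟨Dv, eDv⟩ : ∃ D, D = 2 - u - v + 2*u*v := ⟨_, rfl⟩
  rw [← eDw] at hDw ⊢
  rw [← eDv] at hDv
  rcases le_or_gt ((1 - v)*(2 - u)*Dw) ((1 - u^2)*(2 - v)*(2 - v - w)) with h | h
  · refine (end_zero hu hv hu1 hv1).trans (mul_le_mul_of_nonneg_left ?_ h5)
    have e : (u + w) / Dw + (v - w) / (2 - v - w) - (u / (2 - u) + v / (2 - v))
        = 2 * w * ((1 - u^2)*(2 - v)*(2 - v - w) - (1 - v)*(2 - u)*Dw)
          / (Dw * (2 - v - w) * (2 - u) * (2 - v)) := by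
      have a1 : (u + w) / Dw - u / (2 - u) = 2 * w * (1 - u^2) / (Dw * (2 - u)) := by
        rw [div_sub_div _ _ hDw.ne' hu2.ne']
        congr 1
        rw [eDw]; ring
      have a2 : (v - w) / (2 - v - w) - v / (2 - v)
          = - (2 * w * (1 - v)) / ((2 - v - w) * (2 - v)) := by
        rw [div_sub_div _ _ hvw.ne' hv2.ne']
        congr 1
        ring
      rw [show (u + w) / Dw + (v - w) / (2 - v - w) - (u / (2 - u) + v / (2 - v))
        = ((u + w) / Dw - u / (2 - u)) + ((v - w) / (2 - v - w) - v / (2 - v)) by ring, a1, a2]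
      field_simp
      ring
    have : 0 ≤ 2 * w * ((1 - u^2)*(2 - v)*(2 - v - w) - (1 - v)*(2 - u)*Dw)
          / (Dw * (2 - v - w) * (2 - u) * (2 - v)) := by
      have := sub_nonneg.2 h
      positivity
    linarith
  · have hb : (u + v) / Real.sqrt ((u + v)^2 + 4*(1 - u)*(1 - v))
        ≤ Real.sqrt 5 / 2 * ((u + v) / Dv) :=
      sqrt5_bound (Q_pos hu hv hu1 hv1) hDv (by positivity)
        (by rw [eDv]; exact end_v hu hv hu1 hv1)
    refine hb.trans (mul_le_mul_of_nonneg_left ?_ h5)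
    have k1 : 2 * (1 - v) * (2 - u) ≤ (2 - v) * Dv := by
      have : 0 ≤ v * (u + 2 * u * (1 - v) + v) := by
        have : 0 ≤ 1 - v := by linarith
        positivity
      rw [eDv]; nlinarith
    have k2 := mul_le_mul_of_nonneg_right k1 hDw.le
    have k3 : (2 - v) * (2 * (1 - u^2) * (2 - v - w)) ≤ (2 - v) * (Dv * Dw) := by nlinarith
    have k4 := le_of_mul_le_mul_left k3 hv2
    have e : (u + w) / Dw + (v - w) / (2 - v - w) - (u + v) / Dv
        = (v - w) * (Dv * Dw - 2 * (1 - u^2) * (2 - v - w)) / (Dw * Dv * (2 - v - w)) := by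
      have a1 : (u + w) / Dw - (u + v) / Dv = - (2 * (v - w) * (1 - u^2)) / (Dw * Dv) := by
        rw [div_sub_div _ _ hDw.ne' hDv.ne']
        congr 1
        rw [eDw, eDv]; ring
      rw [show (u + w) / Dw + (v - w) / (2 - v - w) - (u + v) / Dv
        = ((u + w) / Dw - (u + v) / Dv) + (v - w) / (2 - v - w) by ring, a1]
      field_simp
      ring
    have : 0 ≤ (v - w) * (Dv * Dw - 2 * (1 - u^2) * (2 - v - w)) / (Dw * Dv * (2 - v - w)) := by
      have := sub_nonneg.2 k4
      have := sub_nonneg.2 hwv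
      positivity
    linarith

lemma one_le_c : 1 ≤ Real.sqrt 5 / 2 := by
  have : 2 ≤ Real.sqrt 5 := Real.le_sqrt_of_sq_le (by norm_num)
  linarith

lemma weaken {a b : ℝ} (h : a ≤ b) (hb : 0 ≤ b) : a ≤ Real.sqrt 5 / 2 * b := by
  nlinarith [one_le_c]

/-- Opposite signs, middle point nonnegative. -/
lemma opp_case {u v w : ℝ} (hu : 0 ≤ u) (hv : 0 ≤ v) (hw : 0 ≤ w) (hu1 : u < 1) (hv1 : v < 1)
    (hw1 : w < 1) : ppq (-u) v ≤ Real.sqrt 5 / 2 * (ppq (-u) w + ppq w v) := by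
  rcases le_total w v with h | h
  · rw [ppq_opp hu hv, ppq_opp hu hw, ppq_same hw hv hw1 hv1, abs_sub_comm,
      abs_of_nonneg (sub_nonneg.2 h), show 2 - w - v = 2 - v - w by ring]
    refine (key hu hw h hu1 hv1).trans (mul_le_mul_of_nonneg_left ?_ (by positivity))
    gcongr 1
    exact low_bound hu hw hu1 hw1
  · apply weaken _ (add_nonneg (ppq_nonneg _ _) (ppq_nonneg _ _))
    have : ppq (-u) v ≤ ppq (-u) w := by
      rw [ppq_opp hu hv, ppq_opp hu hw]
      have a1 : 0 < 1 - u := by linarith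
      have a2 : 0 < 1 - w := by linarith
      exact div_sqrt_mono (by positivity) (by linarith) (by positivity) (by gcongr)
    linarith [ppq_nonneg w v]

lemma opp_all {u v z : ℝ} (hu : 0 ≤ u) (hv : 0 ≤ v) (hu1 : u < 1) (hv1 : v < 1)
    (hz : |z| < 1) : ppq (-u) v ≤ Real.sqrt 5 / 2 * (ppq (-u) z + ppq z v) := by
  rcases le_total 0 z with h | h
  · exact opp_case hu hv h hu1 hv1 (abs_lt.1 hz).2
  · have := opp_case hv hu (neg_nonneg.2 h) hv1 hu1 (by linarith [(abs_lt.1 hz).1])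
    have e1 := ppq_neg v (-u)
    have e2 := ppq_neg v z
    have e3 := ppq_neg z (-u)
    rw [neg_neg] at e1 e3
    rw [e1, e2, e3, ppq_comm v, ppq_comm v, ppq_comm z (-u)] at this
    linarith

theorem ppf_quasi_interval
    (p : ℝ → ℝ → ℝ)
    (hp : ∀ x y, p x y = |x - y| / Real.sqrt ((x - y)^2 + 4*(1 - |x|)*(1 - |y|)))
    (x y z : ℝ) (hx : x ∈ Set.Ioo (-1 : ℝ) 1) (hy : y ∈ Set.Ioo (-1 : ℝ) 1)
    (hz : z ∈ Set.Ioo (-1 : ℝ) 1) :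
    p x y ≤ (Real.sqrt 5 / 2) * (p x z + p z y) := by
  have hpp : p = ppq := by
    funext a b
    exact hp a b
  rw [hpp]
  have hz' : |z| < 1 := abs_lt.2 hz
  have hzn : |-z| < 1 := by rwa [abs_neg]
  obtain ⟨hx0, hx1⟩ := hx
  obtain ⟨hy0, hy1⟩ := hy
  have hnn := add_nonneg (ppq_nonneg x z) (ppq_nonneg z y)
  rcases le_total 0 x with h | h <;> rcases le_total 0 y with h' | h'
  · exact weaken (ppq_tri_same h h' hx1 hy1 hz') hnn
  · have := opp_all (neg_nonneg.2 h') h (by linarith) hx1 hz'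
    rw [neg_neg, ppq_comm y x, ppq_comm y z, ppq_comm z x] at this
    linarith
  · have := opp_all (neg_nonneg.2 h) h' (by linarith) hy1 hz'
    rwa [neg_neg] at this
  · have := ppq_tri_same (neg_nonneg.2 h) (neg_nonneg.2 h') (by linarith) (by linarith) hzn
    rw [ppq_neg, ppq_neg, ppq_neg] at this
    exact weaken this hnn
end

section
/- For 0 < α ≤ 12 and n ≥ 2, the function p(x,y) = |x − y|/√(|x − y|² + α|x||y|) is a metric on ℝⁿ \ {0}; in particular it satisfies the triangle inequality for all nonzero x, y, z ∈ ℝⁿ. For α > 12 it is not a metric. -/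
noncomputable def ppfG (β A : ℝ) : ℝ := A / Real.sqrt (A ^ 2 + β)

lemma ppfG_mono {β A B : ℝ} (hβ : 0 < β) (hA : 0 ≤ A) (hAB : A ≤ B) : ppfG β A ≤ ppfG β B := by
  unfold ppfG
  have hB : 0 ≤ B := hA.trans hAB
  rw [div_le_div_iff₀ (by positivity) (by positivity)]
  refine le_of_pow_le_pow_left₀ two_ne_zero (by positivity) ?_
  rw [mul_pow, mul_pow, Real.sq_sqrt (by positivity), Real.sq_sqrt (by positivity)]
  have : A ^ 2 ≤ B ^ 2 := by gcongr
  nlinarith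

lemma ppf_key {k v w : ℝ} (hk : -1 < k) (hk2 : k ≤ 2) (hv : 1 ≤ v) (hw : v ≤ w) :
    w * (v + k) ^ 3 ≤ v * (w + k) ^ 3 := by
  have hw1 : 1 ≤ w := hv.trans hw
  have hvw : 1 ≤ v * w := by nlinarith
  have h : 0 ≤ v * w * (v + w + 3 * k) - k ^ 3 := by
    rcases le_or_gt 0 k with h0 | h0
    · have : 0 ≤ (2 - k) * (1 + k) ^ 2 := mul_nonneg (by linarith) (sq_nonneg _)
      have : 0 ≤ (v * w - 1) * (v + w + 3 * k) := mul_nonneg (by linarith) (by linarith)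
      nlinarith
    · have hk3 : k ^ 3 < 0 := by
        have : 0 < (-k) ^ 3 := by apply pow_pos; linarith
        nlinarith
      rcases le_or_gt 0 (v + w + 3 * k) with h1 | h1
      · have : 0 ≤ v * w * (v + w + 3 * k) := by positivity
        linarith
      · have h2 : 0 ≤ ((v + w) ^ 2 / 4 - v * w) * (-(v + w + 3 * k)) :=
          mul_nonneg (by nlinarith [sq_nonneg (v - w)]) (by linarith)
        have h3 : 0 ≤ (v + w + 2 * k) ^ 2 * (v + w - k) := mul_nonneg (sq_nonneg _) (by linarith)
        nlinarith
  have : 0 ≤ (w - v) * (v * w * (v + w + 3 * k) - k ^ 3) := mul_nonneg (by linarith) h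
  nlinarith

noncomputable def ppfD (β t : ℝ) : ℝ :=
  β * Real.cosh t / Real.sqrt (Real.sinh t ^ 2 + β) ^ 3

lemma ppf_hasDeriv {β : ℝ} (hβ : 0 < β) (t : ℝ) :
    HasDerivAt (fun t => ppfG β (Real.sinh t)) (ppfD β t) t := by
  unfold ppfG ppfD
  have hpos : 0 < Real.sinh t ^ 2 + β := by positivity
  have h1 : HasDerivAt (fun t => Real.sinh t ^ 2 + β) (2 * Real.sinh t * Real.cosh t) t := by
    simpa using ((Real.hasDerivAt_sinh t).pow 2).add_const β
  have h2 := (Real.hasDerivAt_sinh t).div (h1.sqrt hpos.ne') (Real.sqrt_pos.2 hpos).ne'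
  refine h2.congr_deriv ?_
  have hs := Real.sq_sqrt hpos.le
  have hs0 := Real.sqrt_pos.2 hpos
  generalize Real.sqrt (Real.sinh t ^ 2 + β) = s at hs hs0
  have hb : β = s ^ 2 - Real.sinh t ^ 2 := by linarith
  rw [hb]
  field_simp

lemma ppfD_anti {β a b : ℝ} (hβ : 0 < β) (hβ3 : β ≤ 3) (ha : 0 ≤ a) (hab : a ≤ b) :
    ppfD β b ≤ ppfD β a := by
  unfold ppfD
  have hpa : 0 < Real.sinh a ^ 2 + β := by positivity
  have hpb : 0 < Real.sinh b ^ 2 + β := by positivity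
  have hca := Real.cosh_pos a
  have hcb := Real.cosh_pos b
  rw [div_le_div_iff₀ (by positivity) (by positivity)]
  refine le_of_pow_le_pow_left₀ two_ne_zero (by positivity) ?_
  have e : ∀ x : ℝ, 0 < x → (Real.sqrt x ^ 3) ^ 2 = x ^ 3 := by
    intro x hx
    rw [← pow_mul, mul_comm, pow_mul, Real.sq_sqrt hx.le]
  rw [mul_pow, mul_pow, mul_pow, mul_pow, e _ hpa, e _ hpb]
  have h1 : Real.cosh a ≤ Real.cosh b := by
    rw [Real.cosh_le_cosh, abs_of_nonneg ha, abs_of_nonneg (ha.trans hab)]; exact hab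
  have h2 : (1:ℝ) ≤ Real.cosh a ^ 2 := by nlinarith [Real.one_le_cosh a]
  have h3 : Real.cosh a ^ 2 ≤ Real.cosh b ^ 2 := by gcongr
  have := ppf_key (k := β - 1) (by linarith) (by linarith) h2 h3
  rw [Real.sinh_sq, Real.sinh_sq]
  have e1 : Real.cosh a ^ 2 - 1 + β = Real.cosh a ^ 2 + (β - 1) := by ring
  have e2 : Real.cosh b ^ 2 - 1 + β = Real.cosh b ^ 2 + (β - 1) := by ring
  rw [e1, e2, mul_assoc, mul_assoc]
  gcongr

lemma ppf_subadd {β a b : ℝ} (hβ : 0 < β) (hβ3 : β ≤ 3) (ha : 0 ≤ a) (hb : 0 ≤ b) :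
    ppfG β (Real.sinh (a + b)) ≤ ppfG β (Real.sinh a) + ppfG β (Real.sinh b) := by
  have hd : ∀ t, HasDerivAt (fun t => ppfG β (Real.sinh t) - ppfG β (Real.sinh (t + b)))
      (ppfD β t - ppfD β (t + b)) t := fun t =>
    (ppf_hasDeriv hβ t).sub ((ppf_hasDeriv hβ (t + b)).comp_add_const t b)
  have hm : MonotoneOn (fun t => ppfG β (Real.sinh t) - ppfG β (Real.sinh (t + b)))
      (Set.Ici 0) := by
    apply monotoneOn_of_deriv_nonneg (convex_Ici 0)
    · exact fun t _ => (hd t).continuousAt.continuousWithinAt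
    · exact fun t _ => (hd t).differentiableAt.differentiableWithinAt
    · intro t ht
      rw [interior_Ici] at ht
      rw [(hd t).deriv]
      have := ppfD_anti hβ hβ3 (le_of_lt ht) (show t ≤ t + b by linarith)
      linarith
  have := hm (Set.mem_Ici.2 le_rfl) (Set.mem_Ici.2 ha) ha
  simp [ppfG] at this
  simp only [ppfG]
  linarith

lemma ppf_eq {d r s α : ℝ} (hr : 0 < r) (hs : 0 < s) (hα : 0 < α) :
    d / Real.sqrt (d ^ 2 + α * r * s)
      = ppfG (α / 4) (d / (2 * (Real.sqrt r * Real.sqrt s))) := by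
  unfold ppfG
  have hr' := Real.sqrt_pos.2 hr
  have hs' := Real.sqrt_pos.2 hs
  have : d ^ 2 + α * r * s = (2 * (Real.sqrt r * Real.sqrt s)) ^ 2 *
      ((d / (2 * (Real.sqrt r * Real.sqrt s))) ^ 2 + α / 4) := by
    have h1 := Real.sq_sqrt hr.le
    have h2 := Real.sq_sqrt hs.le
    generalize Real.sqrt r = R at *
    generalize Real.sqrt s = S at *
    subst h1 h2
    field_simp
    ring
  rw [this, Real.sqrt_mul (by positivity), Real.sqrt_sq (by positivity), div_div]

lemma ppf_tri {E : Type*} [NormedAddCommGroup E] [InnerProductSpace ℝ E] {x y z : E}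
    (hx : x ≠ 0) (hy : y ≠ 0) (hz : z ≠ 0) :
    Real.arsinh (‖x - y‖ / (2 * (Real.sqrt ‖x‖ * Real.sqrt ‖y‖))) ≤
    Real.arsinh (‖x - z‖ / (2 * (Real.sqrt ‖x‖ * Real.sqrt ‖z‖))) +
    Real.arsinh (‖z - y‖ / (2 * (Real.sqrt ‖z‖ * Real.sqrt ‖y‖))) := by
  have key : ∀ u v : E, u ≠ 0 → v ≠ 0 → ‖u + v‖ / (2 * (Real.sqrt ‖u‖ * Real.sqrt ‖v‖)) ≤
      Real.sqrt (1 + (‖u - v‖ / (2 * (Real.sqrt ‖u‖ * Real.sqrt ‖v‖))) ^ 2) := by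
    intro u v hu hv
    have hu' := norm_pos_iff.2 hu
    have hv' := norm_pos_iff.2 hv
    apply Real.le_sqrt_of_sq_le
    rw [div_pow, div_pow, mul_pow, mul_pow, Real.sq_sqrt hu'.le, Real.sq_sqrt hv'.le,
      ← sub_nonneg]
    have h1 := norm_add_sq_real u v
    have h2 := norm_sub_sq_real u v
    have h3 := real_inner_le_norm u v
    have : 1 + ‖u - v‖ ^ 2 / (2 ^ 2 * (‖u‖ * ‖v‖)) - ‖u + v‖ ^ 2 / (2 ^ 2 * (‖u‖ * ‖v‖))
      = (4 * (‖u‖ * ‖v‖) + ‖u - v‖ ^ 2 - ‖u + v‖ ^ 2) / (2 ^ 2 * (‖u‖ * ‖v‖)) := by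
      field_simp
      ring
    rw [this]
    apply div_nonneg _ (by positivity)
    linarith
  have pt := EuclideanGeometry.mul_dist_le_mul_dist_add_mul_dist x z y (-z)
  simp only [dist_eq_norm, sub_neg_eq_add] at pt
  have hzz : ‖z + z‖ = 2 * ‖z‖ := by rw [← two_smul ℝ z, norm_smul]; simp
  rw [hzz] at pt
  rw [← Real.sinh_le_sinh, Real.sinh_add, Real.sinh_arsinh, Real.sinh_arsinh, Real.sinh_arsinh,
    Real.cosh_arsinh, Real.cosh_arsinh]
  have k1 := key x z hx hz
  have k2 := key z y hz hy
  have hx' := Real.sqrt_pos.2 (norm_pos_iff.2 hx)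
  have hy' := Real.sqrt_pos.2 (norm_pos_iff.2 hy)
  have hz' := Real.sqrt_pos.2 (norm_pos_iff.2 hz)
  calc _ ≤ ‖x - z‖ / (2 * (Real.sqrt ‖x‖ * Real.sqrt ‖z‖)) *
        (‖z + y‖ / (2 * (Real.sqrt ‖z‖ * Real.sqrt ‖y‖))) +
        ‖x + z‖ / (2 * (Real.sqrt ‖x‖ * Real.sqrt ‖z‖)) *
        (‖z - y‖ / (2 * (Real.sqrt ‖z‖ * Real.sqrt ‖y‖))) := by
        have hq := Real.sq_sqrt (norm_nonneg z)
        rw [← hq, add_comm y z] at pt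
        generalize Real.sqrt ‖x‖ = X at *
        generalize Real.sqrt ‖y‖ = Y at *
        generalize Real.sqrt ‖z‖ = Z at *
        rw [← sub_nonneg]
        have : ‖x - z‖ / (2 * (X * Z)) * (‖z + y‖ / (2 * (Z * Y))) +
          ‖x + z‖ / (2 * (X * Z)) * (‖z - y‖ / (2 * (Z * Y))) - ‖x - y‖ / (2 * (X * Y)) =
          (‖x - z‖ * ‖z + y‖ + ‖z - y‖ * ‖x + z‖ - ‖x - y‖ * (2 * Z ^ 2)) /
            (4 * X * Y * Z ^ 2) := by
          field_simp
          ring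
        rw [this]
        exact div_nonneg (by linarith) (by positivity)
    _ ≤ _ := by gcongr

lemma ppf_counter {α : ℝ} (hα : 12 < α) : ∃ q : ℝ, 1 < q ∧
    2 * ppfG (α / 4) ((q ^ 2 - 1) / (2 * q)) < ppfG (α / 4) ((q ^ 4 - 1) / (2 * q ^ 2)) := by
  have h0 : 0 < Real.sqrt (α - 12) := Real.sqrt_pos.2 (by linarith)
  have hs := Real.sq_sqrt (show 0 ≤ α - 12 by linarith)
  obtain ⟨ε, hε⟩ : ∃ ε, ε = Real.sqrt (α - 12) / 4 := ⟨_, rfl⟩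
  have hε0 : 0 < ε := by rw [hε]; positivity
  have hε2 : 16 * ε ^ 2 = α - 12 := by rw [hε]; linarith
  refine ⟨1 + ε, by linarith, ?_⟩
  obtain ⟨q, hq⟩ : ∃ q, q = 1 + ε := ⟨_, rfl⟩
  rw [← hq]
  have hq0 : 0 < q := by linarith
  obtain ⟨h, hh⟩ : ∃ h, h = (q ^ 2 - 1) / (2 * q) := ⟨_, rfl⟩
  have hh0 : 0 < h := by rw [hh]; apply div_pos <;> nlinarith
  have hhε : h ≤ ε := by
    rw [hh, div_le_iff₀ (by positivity)]; subst hq; nlinarith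
  have hc : (q ^ 4 - 1) / (2 * q ^ 2) = h * ((q ^ 2 + 1) / q) := by
    rw [hh]; field_simp; ring
  have hm : ((q ^ 2 + 1) / q) ^ 2 = 4 * h ^ 2 + 4 := by
    rw [hh]; field_simp; ring
  rw [hc, ← hh]
  have hm0 : 0 < (q ^ 2 + 1) / q := by positivity
  generalize (q ^ 2 + 1) / q = m at *
  unfold ppfG
  rw [← mul_div_assoc, div_lt_div_iff₀ (by positivity) (by positivity)]
  apply lt_of_pow_lt_pow_left₀ 2 (by positivity)
  rw [mul_pow, mul_pow _ (Real.sqrt (h ^ 2 + α / 4)), Real.sq_sqrt (by positivity),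
    Real.sq_sqrt (by positivity), mul_pow, mul_pow, hm]
  have hle : h ^ 2 ≤ ε ^ 2 := by gcongr
  have : 0 < h ^ 4 * (α - 12 - 12 * h ^ 2) := mul_pos (by positivity) (by nlinarith)
  nlinarith

theorem ppf_alpha_punctured (n : ℕ) (hn : 2 ≤ n) (α : ℝ) (hα : 0 < α)
    (p : EuclideanSpace ℝ (Fin n) → EuclideanSpace ℝ (Fin n) → ℝ)
    (hp : ∀ x y, p x y = ‖x - y‖ / Real.sqrt (‖x - y‖^2 + α * ‖x‖ * ‖y‖)) :
    (α ≤ 12 →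
      (∀ x y z : EuclideanSpace ℝ (Fin n), x ≠ 0 → y ≠ 0 → z ≠ 0 →
        p x y ≤ p x z + p z y) ∧
      (∀ x y : EuclideanSpace ℝ (Fin n), x ≠ 0 → y ≠ 0 → p x y = p y x) ∧
      (∀ x y : EuclideanSpace ℝ (Fin n), x ≠ 0 → y ≠ 0 → (p x y = 0 ↔ x = y))) ∧
    (12 < α → ∃ x y z : EuclideanSpace ℝ (Fin n), x ≠ 0 ∧ y ≠ 0 ∧ z ≠ 0 ∧
      p x y > p x z + p z y) := by
  have hp' : ∀ x y, x ≠ 0 → y ≠ 0 → p x y =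
      ppfG (α / 4) (‖x - y‖ / (2 * (Real.sqrt ‖x‖ * Real.sqrt ‖y‖))) := by
    intro x y hx hy
    rw [hp, ppf_eq (norm_pos_iff.2 hx) (norm_pos_iff.2 hy) hα]
  refine ⟨fun h12 => ⟨?_, ?_, ?_⟩, ?_⟩
  · intro x y z hx hy hz
    rw [hp' x y hx hy, hp' x z hx hz, hp' z y hz hy]
    have ht := ppf_tri hx hy hz
    have hsub := ppf_subadd (β := α / 4)
      (a := Real.arsinh (‖x - z‖ / (2 * (Real.sqrt ‖x‖ * Real.sqrt ‖z‖))))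
      (b := Real.arsinh (‖z - y‖ / (2 * (Real.sqrt ‖z‖ * Real.sqrt ‖y‖))))
      (by linarith) (by linarith) (Real.arsinh_nonneg_iff.2 (by positivity))
      (Real.arsinh_nonneg_iff.2 (by positivity))
    rw [Real.sinh_arsinh, Real.sinh_arsinh] at hsub
    refine le_trans (ppfG_mono (by linarith) (by positivity) ?_) hsub
    rwa [← Real.sinh_le_sinh, Real.sinh_arsinh] at ht
  · intro x y _ _
    rw [hp, hp, norm_sub_rev, mul_right_comm]
  · intro x y hx hy
    have hx' := norm_pos_iff.2 hx
    have hy' := norm_pos_iff.2 hy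
    have : 0 < Real.sqrt (‖x - y‖^2 + α * ‖x‖ * ‖y‖) := by positivity
    rw [hp, div_eq_zero_iff, or_iff_left this.ne', norm_eq_zero, sub_eq_zero]
  · intro h12
    obtain ⟨q, hq, hlt⟩ := ppf_counter h12
    have hq0 : 0 < q := by linarith
    obtain ⟨e, he⟩ : ∃ e : EuclideanSpace ℝ (Fin n), ‖e‖ = 1 :=
      ⟨EuclideanSpace.single ⟨0, by omega⟩ 1, by simp⟩
    have he0 : e ≠ 0 := by rw [← norm_pos_iff, he]; exact one_pos
    have hne : ∀ c : ℝ, 0 < c → c • e ≠ 0 := fun c hc => smul_ne_zero hc.ne' he0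
    have hG : ∀ c d : ℝ, 0 < c → c ≤ d → p ((d ^ 2) • e) ((c ^ 2) • e) =
        ppfG (α / 4) ((d ^ 2 - c ^ 2) / (2 * (d * c))) := by
      intro c d hc hcd
      have hd : 0 < d := by linarith
      have : c ^ 2 ≤ d ^ 2 := by gcongr
      rw [hp' _ _ (hne _ (by positivity)) (hne _ (by positivity)), ← sub_smul, norm_smul,
        norm_smul, norm_smul, he, mul_one, mul_one, mul_one, Real.norm_of_nonneg (by linarith),
        Real.norm_of_nonneg (by positivity), Real.norm_of_nonneg (by positivity),
        Real.sqrt_sq hd.le, Real.sqrt_sq hc.le]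
    refine ⟨((q ^ 2) ^ 2) • e, ((1 : ℝ) ^ 2) • e, (q ^ 2) • e, hne _ (by positivity),
      hne _ (by positivity), hne _ (by positivity), ?_⟩
    rw [hG 1 (q ^ 2) one_pos (by nlinarith), hG q (q ^ 2) hq0 (by nlinarith),
      hG 1 q one_pos hq.le]
    have e1 : ((q ^ 2) ^ 2 - 1 ^ 2) / (2 * (q ^ 2 * 1)) = (q ^ 4 - 1) / (2 * q ^ 2) := by ring
    have e2 : ((q ^ 2) ^ 2 - q ^ 2) / (2 * (q ^ 2 * q)) = (q ^ 2 - 1) / (2 * q) := by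
      field_simp
    have e3 : (q ^ 2 - 1 ^ 2) / (2 * (q * 1)) = (q ^ 2 - 1) / (2 * q) := by ring
    rw [e1, e2, e3]
    linarith
end
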